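/- Let X be a regular curve and f : X → X a homeomorphism. Then for every x ∈ X, the ω-limit set ω_f(x) is a minimal set of f, and the α-limit set α_f(x) is a minimal set of f. -/

import Mathlib

open Set Filter Metric Topology

/-- The defining condition of a regular curve: every point has arbitrarily small
open neighborhoods with finite boundary. (Together with the instance assumptions
`Nonempty`, `CompactSpace`, `ConnectedSpace` on a metric space, this says `X` is a
regular curve.) -/
def regularCurveAx (X : Type*) [MetricSpace X] : Prop :=
  ∀ (x : X) (V : Set X), IsOpen V → x ∈ V →
    ∃ U : Set X, IsOpen U ∧ x ∈ U ∧ U ⊆ V ∧ (frontier U).Finite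

/-- The ω-limit set of `x` under `f`: all limits of `f^[n i] x` along a strictly
increasing sequence of integers `n`. -/
def omegaSet {X : Type*} [MetricSpace X] (f : X → X) (x : X) : Set X :=
  {y | ∃ n : ℕ → ℕ, StrictMono n ∧ Tendsto (fun i => f^[n i] x) atTop (𝓝 y)}

/-- `M` is a minimal set of `f`: nonempty, closed, strongly invariant, and without
any proper nonempty closed strongly invariant subset. -/
def IsMinimalSet {X : Type*} [MetricSpace X] (f : X → X) (M : Set X) : Prop :=
  M.Nonempty ∧ IsClosed M ∧ f '' M = M ∧
    ∀ N : Set X, N ⊆ M → N.Nonempty → IsClosed N → f '' N = N → N = M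

lemma IsPreconnected.subset_of_disjoint_frontier {X : Type*} [TopologicalSpace X] {A U : Set X}
    (hA : IsPreconnected A) (hU : IsOpen U) (h : Disjoint A (frontier U))
    (hne : (A ∩ U).Nonempty) : A ⊆ U := by
  refine hA.subset_left_of_subset_union hU isClosed_closure.isOpen_compl
    (disjoint_compl_right.mono_left subset_closure |>.mono_right le_rfl) (fun a ha => ?_) hne
  by_cases haU : a ∈ U
  · exact Or.inl haU
  · refine Or.inr fun hc => h.notMem_of_mem_left ha ?_
    rw [hU.frontier_eq]
    exact ⟨hc, haU⟩

/-- Boundary bumping: in a continuum, every component of a proper closed subset meets its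
frontier. -/
lemma connectedComponentIn_inter_frontier_nonempty {X : Type*} [TopologicalSpace X] [T2Space X]
    [CompactSpace X] [PreconnectedSpace X] {K : Set X} (hK : IsClosed K) (hne : K ≠ univ) {x : X}
    (hx : x ∈ K) : (connectedComponentIn K x ∩ frontier K).Nonempty := by
  by_contra hemp
  rw [connectedComponentIn_eq_image hx, not_nonempty_iff_eq_empty] at hemp
  have : CompactSpace K := isCompact_iff_compactSpace.1 hK.isCompact
  set G : Set K := (↑) ⁻¹' frontier K with hG
  have hGc : IsCompact G := (isClosed_frontier.preimage continuous_subtype_val).isCompact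
  obtain ⟨u, hu⟩ := hGc.elim_finite_subfamily_closed
    (fun s : {s : Set K // IsClopen s ∧ (⟨x, hx⟩ : K) ∈ s} => (s : Set K))
    (fun s => s.2.1.isClosed) (by
      rw [← connectedComponent_eq_iInter_isClopen]
      ext w
      simp only [mem_inter_iff, mem_empty_iff_false, iff_false, not_and]
      intro hw hw'
      have : (w : X) ∈ (∅ : Set X) := hemp ▸ ⟨⟨w, hw', rfl⟩, hw⟩
      exact this)
  set S : Set K := ⋂ i ∈ u, (i : Set K) with hS
  have hSc : IsClopen S := u.finite_toSet.isClopen_biInter fun i _ => i.2.1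
  have hxS : (⟨x, hx⟩ : K) ∈ S := mem_iInter₂.2 fun i _ => i.2.2
  have hclosed : IsClosed ((↑) '' S : Set X) := hK.isClosedEmbedding_subtypeVal.isClosedMap _ hSc.1
  have hopen : IsOpen ((↑) '' S : Set X) := by
    obtain ⟨O, hO, hOS⟩ := isOpen_induced_iff.1 hSc.2
    have : ((↑) '' S : Set X) = O ∩ interior K := by
      ext w
      constructor
      · rintro ⟨v, hv, rfl⟩
        refine ⟨by rw [← hOS] at hv; exact hv, ?_⟩
        by_contra hvi
        have : v ∈ G ∩ S := ⟨by rw [hG, mem_preimage, hK.frontier_eq]; exact ⟨v.2, hvi⟩, hv⟩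
        rw [hu] at this
        exact this
      · rintro ⟨hwO, hwK⟩
        exact ⟨⟨w, interior_subset hwK⟩, by rw [← hOS]; exact hwO, rfl⟩
    rw [this]
    exact hO.inter isOpen_interior
  have := IsClopen.eq_univ ⟨hclosed, hopen⟩ ⟨x, _, hxS, rfl⟩
  refine hne (eq_univ_of_univ_subset ?_)
  rw [← this]
  rintro _ ⟨v, -, rfl⟩
  exact v.2

/-- In a regular curve every point has arbitrarily small connected neighborhoods. -/
lemma regularCurveAx.exists_isPreconnected_mem_nhds {X : Type*} [MetricSpace X] [CompactSpace X]
    [PreconnectedSpace X] (hreg : regularCurveAx X) {z : X} {O : Set X} (hO : O ∈ 𝓝 z) :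
    ∃ A ∈ 𝓝 z, A ⊆ O ∧ IsPreconnected A := by
  obtain ⟨O', hO'z, hO'c, hO'O⟩ := exists_mem_nhds_isClosed_subset hO
  obtain ⟨U, hU, hzU, hUO, hfin⟩ := hreg z (interior O') isOpen_interior
    (mem_interior_iff_mem_nhds.2 hO'z)
  have hsub : closure U ⊆ O := (closure_minimal (hUO.trans interior_subset) hO'c).trans hO'O
  have hfin' : (frontier (closure U)).Finite := hfin.subset frontier_closure_subset
  refine ⟨connectedComponentIn (closure U) z, ?_, (connectedComponentIn_subset _ _).trans hsub,
    isPreconnected_connectedComponentIn⟩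
  by_cases huniv : closure U = univ
  · rw [huniv, connectedComponentIn_univ, PreconnectedSpace.connectedComponent_eq_univ]
    exact univ_mem
  set C := fun w => connectedComponentIn (closure U) w with hC
  have hCc : ∀ w, IsClosed (C w) := fun w => by
    by_cases hw : w ∈ closure U
    · simp only [hC, connectedComponentIn_eq_image hw]
      exact isClosed_closure.isClosedEmbedding_subtypeVal.isClosedMap _ isClosed_connectedComponent
    · simp only [hC, connectedComponentIn_eq_empty hw, isClosed_empty]
  set R : Set X := ⋃ q ∈ frontier (closure U) \ C z, C q with hR
  have hRc : IsClosed R := (hfin'.subset sdiff_subset).isClosed_biUnion fun q _ => hCc q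
  have hzR : z ∉ R := by
    intro hz
    obtain ⟨q, hq, hzq⟩ := mem_iUnion₂.1 hz
    have h1 := connectedComponentIn_eq hzq
    refine hq.2 ?_
    change q ∈ connectedComponentIn _ _
    rw [← h1]
    exact mem_connectedComponentIn (isClosed_closure.frontier_subset hq.1)
  filter_upwards [hU.mem_nhds hzU, hRc.isOpen_compl.mem_nhds hzR] with w hwU hwR
  obtain ⟨q, hqw, hq⟩ := connectedComponentIn_inter_frontier_nonempty isClosed_closure huniv
    (subset_closure hwU)
  have h1 := connectedComponentIn_eq hqw
  have hwq : w ∈ C q := by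
    change w ∈ connectedComponentIn _ _
    rw [← h1]
    exact mem_connectedComponentIn (subset_closure hwU)
  by_cases hqz : q ∈ C z
  · change w ∈ C z
    have : C z = C q := connectedComponentIn_eq hqz
    rw [this]
    exact hwq
  · exact absurd (mem_iUnion₂.2 ⟨q, ⟨hq, hqz⟩, hwq⟩) hwR

/-- In a regular curve, a finite set meets every connected set that is not small. -/
lemma regularCurveAx.exists_finite_inter_nonempty {X : Type*} [MetricSpace X] [CompactSpace X]
    (hreg : regularCurveAx X) {η : ℝ} (hη : 0 < η) :
    ∃ Φ : Set X, Φ.Finite ∧ ∀ A : Set X, IsPreconnected A →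
      ∀ a ∈ A, ∀ b ∈ A, η ≤ dist a b → ∃ φ ∈ Φ, φ ∈ A := by
  choose U hU hxU hUb hfin using fun x : X =>
    hreg x (ball x (η / 2)) isOpen_ball (mem_ball_self (half_pos hη))
  obtain ⟨s, hs⟩ := CompactSpace.elim_nhds_subcover U fun x => (hU x).mem_nhds (hxU x)
  refine ⟨⋃ x ∈ s, frontier (U x), s.finite_toSet.biUnion fun x _ => hfin x, ?_⟩
  intro A hA a ha b hb hab
  obtain ⟨x, hxs, hax⟩ := mem_iUnion₂.1 (hs ▸ mem_univ a : a ∈ ⋃ x ∈ s, U x)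
  by_contra! hno
  have hAU := hA.subset_of_disjoint_frontier (hU x)
    (disjoint_left.2 fun w hwA hwF => hno w (mem_iUnion₂.2 ⟨x, hxs, hwF⟩) hwA) ⟨a, ha, hax⟩
  have h1 := mem_ball.1 (hUb x hax)
  have h2 := mem_ball.1 (hUb x (hAU hb))
  linarith [dist_triangle_right a b x]

/-- A compact set has arbitrarily small open neighborhoods with finite frontier. -/
lemma regularCurveAx.exists_isOpen_finite_frontier {X : Type*} [MetricSpace X]
    (hreg : regularCurveAx X) {N O : Set X} (hN : IsCompact N) (hO : IsOpen O) (hNO : N ⊆ O) :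
    ∃ V, IsOpen V ∧ N ⊆ V ∧ V ⊆ O ∧ (frontier V).Finite := by
  refine hN.induction_on (p := fun N => ∃ V, IsOpen V ∧ N ⊆ V ∧ V ⊆ O ∧ (frontier V).Finite)
    ⟨∅, isOpen_empty, subset_rfl, empty_subset _, by simp⟩ ?_ ?_ ?_
  · rintro s t hst ⟨V, h1, h2, h3⟩
    exact ⟨V, h1, hst.trans h2, h3⟩
  · rintro s t ⟨V, h1, h2, h3, h4⟩ ⟨W, k1, k2, k3, k4⟩
    refine ⟨V ∪ W, h1.union k1, union_subset_union h2 k2, union_subset h3 k3,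
      (h4.union k4).subset ((frontier_union_subset _ _).trans ?_)⟩
    exact union_subset_union inter_subset_left inter_subset_right
  · intro x hx
    obtain ⟨U, hU, hxU, hUO, hfin⟩ := hreg x O hO (hNO hx)
    exact ⟨U, mem_nhdsWithin_of_mem_nhds (hU.mem_nhds hxU), U, hU, subset_rfl, hUO, hfin⟩

lemma frequently_atTop_exists_mem_finite {α : Type*} {S : Set α} (hS : S.Finite)
    {P : ℤ → α → Prop} (h : ∃ᶠ t in atTop, ∃ φ ∈ S, P t φ) :
    ∃ φ ∈ S, ∃ᶠ t in atTop, P t φ := by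
  by_contra! hno
  refine h ?_
  have := (eventually_all_finite hS (l := atTop) (p := fun φ t => ¬ P t φ)).2
    hno
  filter_upwards [this] with t ht
  rintro ⟨φ, hφ, hP⟩
  exact ht φ hφ hP

section Dynamics

variable {X : Type*}

lemma Homeomorph.zpow_add_apply [TopologicalSpace X] (f : X ≃ₜ X) (a b : ℤ) (x : X) :
    (f ^ (a + b)) x = (f ^ a) ((f ^ b) x) := by
  rw [zpow_add, Homeomorph.mul_apply]

lemma Homeomorph.zpow_zero_apply [TopologicalSpace X] (f : X ≃ₜ X) (x : X) :
    (f ^ (0 : ℤ)) x = x := by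
  rw [zpow_zero]
  rfl

lemma Homeomorph.zpow_neg_apply_eq_iff [TopologicalSpace X] (f : X ≃ₜ X) (a : ℤ) (x y : X) :
    (f ^ (-a)) y = x ↔ y = (f ^ a) x := by
  constructor
  · rintro rfl
    rw [← f.zpow_add_apply, add_neg_cancel, f.zpow_zero_apply]
  · rintro rfl
    rw [← f.zpow_add_apply, neg_add_cancel, f.zpow_zero_apply]

/-- For homeomorphisms of regular curves, nonwandering points are recurrent. -/
lemma regularCurveAx.recurrent_of_nonwandering [MetricSpace X] [CompactSpace X]
    [PreconnectedSpace X] (hreg : regularCurveAx X) (f : X ≃ₜ X) {z : X}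
    (hz : ∀ O ∈ 𝓝 z, ∃ᶠ j : ℤ in atTop, ∃ w ∈ O, (f ^ j) w ∈ O) :
    MapClusterPt z atTop fun j : ℤ => (f ^ j) z := by
  rw [mapClusterPt_iff_frequently]
  intro O hO hnot
  obtain ⟨n₁, hn₁⟩ := eventually_atTop.1 hnot
  obtain ⟨ε, hε, hεO⟩ := Metric.mem_nhds_iff.1 hO
  obtain ⟨η, hη, rfl⟩ : ∃ η > 0, ε = 3 * η := ⟨ε / 3, by positivity, by ring⟩
  set n₀ := max n₁ 1 with hn₀
  have hfar : ∀ j ≥ n₀, 3 * η ≤ dist ((f ^ j) z) z := fun j hj => by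
    by_contra! hlt
    exact hn₁ j ((le_max_left _ _).trans hj) (hεO hlt)
  obtain ⟨Φ, hΦ, hΦA⟩ := hreg.exists_finite_inter_nonempty hη
  have key : ∃ᶠ t : ℤ in atTop, ∃ φ ∈ Φ, (f ^ (-t)) φ ∈ ball z η ∧
      ∀ s, n₀ ≤ s → s < t → (f ^ (s - t)) φ ∉ ball z η := by
    rw [frequently_atTop]
    intro T
    have hnhds : ball z η ∩ ⋂ s ∈ Icc n₀ T, (f ^ s) ⁻¹' ball ((f ^ s) z) η ∈ 𝓝 z := by
      refine inter_mem (ball_mem_nhds _ hη) ((biInter_mem (finite_Icc _ _)).2 fun s _ => ?_)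
      exact (f ^ s).continuous.continuousAt.preimage_mem_nhds (ball_mem_nhds _ hη)
    obtain ⟨A, hAz, hA, hAc⟩ := hreg.exists_isPreconnected_mem_nhds hnhds
    have hzA := mem_of_mem_nhds hAz
    obtain ⟨j, hj, w, hw, hjw⟩ := frequently_atTop.1 (hz A hAz) n₀
    obtain ⟨t, ⟨ht, a, ha, hta⟩, hmin⟩ := Int.exists_least_of_bdd
      (P := fun t => n₀ ≤ t ∧ ∃ a ∈ A, η ≤ dist ((f ^ t) z) ((f ^ t) a)) ⟨n₀, fun t ht => ht.1⟩
      ⟨j, hj, w, hw, by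
        have h1 := hfar j hj
        have h2 := mem_ball.1 (hA hjw).1
        linarith [dist_triangle ((f ^ j) z) ((f ^ j) w) z]⟩
    refine ⟨t, ?_, ?_⟩
    · by_contra! hlt
      have h1 := mem_ball'.1 (mem_iInter₂.1 (hA ha).2 t ⟨ht, hlt.le⟩)
      linarith
    · obtain ⟨_, hφ, b, hb, rfl⟩ := hΦA ((f ^ t) '' A)
        (hAc.image _ (f ^ t).continuous.continuousOn) _ ⟨z, hzA, rfl⟩ _ ⟨a, ha, rfl⟩ hta
      refine ⟨_, hφ, ?_, fun s hs hst hmem => ?_⟩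
      · rw [← f.zpow_add_apply, neg_add_cancel, f.zpow_zero_apply]
        exact (hA hb).1
      · rw [← f.zpow_add_apply, sub_add_cancel] at hmem
        refine hst.not_ge (hmin s ⟨hs, b, hb, ?_⟩)
        linarith [hfar s hs, mem_ball.1 hmem, dist_triangle ((f ^ s) z) ((f ^ s) b) z]
  obtain ⟨φ, -, hφ⟩ := frequently_atTop_exists_mem_finite hΦ key
  obtain ⟨t, ht, ht1, -⟩ := frequently_atTop.1 hφ n₀
  obtain ⟨t', ht', -, ht2⟩ := frequently_atTop.1 hφ (t + n₀)
  have h1 : 1 ≤ n₀ := le_max_right _ _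
  refine ht2 (t' - t) (by omega) (by omega) ?_
  rwa [show t' - t - t' = -t by ring]

/-- For homeomorphisms of regular curves, all long excursions into an open set `V` with finite
frontier are shadowed by orbits of points of the frontier of `V`. -/
lemma regularCurveAx.exists_shadowing_excursions [MetricSpace X] [CompactSpace X]
    [PreconnectedSpace X] (hreg : regularCurveAx X) (f : X ≃ₜ X) {V : Set X} (hV : IsOpen V)
    {η : ℝ} (hη : 0 < η) :
    ∃ T : ℤ, ∀ t ≥ T, ∀ x ∉ V, (∀ s, 0 < s → s < t → (f ^ s) x ∈ V) → (f ^ t) x ∉ V →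
      ∃ q ∈ frontier V, ∃ j, 0 ≤ j ∧ j ≤ t ∧
        ∀ s, 0 ≤ s → s ≤ t → dist ((f ^ s) x) ((f ^ (s - j)) q) ≤ η := by
  obtain ⟨δ', hδ', hunif⟩ := Metric.uniformContinuous_iff.1
    (CompactSpace.uniformContinuous_of_continuous f.continuous) η hη
  set δ := min δ' η with hδ_def
  have hδ : 0 < δ := lt_min hδ' hη
  obtain ⟨Φ, hΦ, hΦA⟩ := hreg.exists_finite_inter_nonempty hδ
  have hfin : (⋃ φ ∈ Φ, {t : ℤ | ∃ s, 0 ≤ s ∧ s < t ∧ (f ^ (-s)) φ ∉ V ∧ (f ^ (t - s)) φ ∉ V ∧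
      ∀ i, 0 < i → i < t → (f ^ (i - s)) φ ∈ V}).Finite := by
    refine hΦ.biUnion fun φ _ => Set.Subsingleton.finite ?_
    rintro t ⟨s, h1, h2, h3, h4, h5⟩ t' ⟨s', h1', h2', h3', h4', h5'⟩
    have hs : s = s' := by
      rcases lt_trichotomy s s' with h | h | h
      · refine absurd ?_ h3
        have := h5' (s' - s) (by omega) (by omega)
        rwa [show s' - s - s' = -s by ring] at this
      · exact h
      · refine absurd ?_ h3'
        have := h5 (s - s') (by omega) (by omega)
        rwa [show s - s' - s = -s' by ring] at this
    subst hs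
    rcases lt_trichotomy t t' with h | h | h
    · exact absurd (h5' t (by omega) h) h4
    · exact h
    · exact absurd (h5 t' (by omega) h) h4'
  obtain ⟨T, hT⟩ := hfin.bddAbove
  refine ⟨max (T + 1) 2, fun t ht x hx hxV hxt => ?_⟩
  have ht2 : 2 ≤ t := (le_max_right _ _).trans ht
  have htT : T < t := by have := (le_max_left _ _).trans ht; omega
  by_contra! hno
  set B : Set X := ⋂ s ∈ Icc 0 t, {w | dist ((f ^ s) x) ((f ^ s) w) ≤ η} with hB
  have hmemB : ∀ w, w ∈ B ↔ ∀ s, 0 ≤ s → s ≤ t → dist ((f ^ s) x) ((f ^ s) w) ≤ η := by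
    simp [hB]
  have hBc : IsClosed B := isClosed_biInter fun s _ =>
    isClosed_le (continuous_const.dist (f ^ s).continuous) continuous_const
  have hxB : x ∈ B := (hmemB x).2 fun s _ _ => by simpa using hη.le
  have hBF : ∀ w ∈ B, ∀ j, 0 ≤ j → j ≤ t → (f ^ j) w ∉ frontier V := by
    intro w hw j hj hjt hF
    obtain ⟨s, hs, hst, hlt⟩ := hno _ hF j hj hjt
    rw [← f.zpow_add_apply, sub_add_cancel] at hlt
    exact hlt.not_ge ((hmemB w).1 hw s hs hst)
  have hBne : B ≠ univ := by
    intro huniv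
    have hVF : (frontier V).Nonempty := nonempty_frontier_iff.2
      ⟨⟨_, hxV 1 (by omega) (by omega)⟩, fun h => hx (h ▸ mem_univ x)⟩
    obtain ⟨q, hq⟩ := hVF
    refine hBF q (huniv ▸ mem_univ q) 0 le_rfl (by omega) ?_
    rwa [f.zpow_zero_apply]
  obtain ⟨w, hwC, hwF⟩ := connectedComponentIn_inter_frontier_nonempty hBc hBne hxB
  set C := connectedComponentIn B x with hC
  have hCc : IsPreconnected C := isPreconnected_connectedComponentIn
  have hxC : x ∈ C := mem_connectedComponentIn hxB
  have hCB : C ⊆ B := connectedComponentIn_subset _ _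
  have hCj : ∀ j : ℤ, IsPreconnected ((f ^ j) '' C) := fun j =>
    hCc.image _ (f ^ j).continuous.continuousOn
  have hdisj : ∀ j, 0 ≤ j → j ≤ t → Disjoint ((f ^ j) '' C) (frontier V) := by
    intro j hj hjt
    refine disjoint_left.2 ?_
    rintro _ ⟨v, hv, rfl⟩
    exact hBF v (hCB hv) j hj hjt
  have hiff : ∀ v ∈ C, ∀ j, 0 ≤ j → j ≤ t → (f ^ j) x ∈ V → (f ^ j) v ∈ V :=
    fun v hv j hj hjt hxj => (hCj j).subset_of_disjoint_frontier hV (hdisj j hj hjt)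
      ⟨_, ⟨x, hxC, rfl⟩, hxj⟩ ⟨v, hv, rfl⟩
  have hiff' : ∀ v ∈ C, ∀ j, 0 ≤ j → j ≤ t → (f ^ j) x ∉ V → (f ^ j) v ∉ V :=
    fun v hv j hj hjt hxj hvj => hxj <| (hCj j).subset_of_disjoint_frontier hV (hdisj j hj hjt)
      ⟨_, ⟨v, hv, rfl⟩, hvj⟩ ⟨x, hxC, rfl⟩
  obtain ⟨s, hs, hst, hdist⟩ : ∃ s, 0 ≤ s ∧ s < t ∧ δ ≤ dist ((f ^ s) x) ((f ^ s) w) := by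
    by_contra! hlt
    have hlt' : ∀ s, 0 ≤ s → s ≤ t → dist ((f ^ s) x) ((f ^ s) w) < η := by
      intro s hs hst
      rcases hst.lt_or_eq with h | rfl
      · exact (hlt s hs h).trans_le (min_le_right _ _)
      · have h1 := hunif ((hlt (s - 1) (by omega) (by omega)).trans_le (min_le_left _ _))
        have h2 : ∀ v, f ((f ^ (s - 1)) v) = (f ^ s) v := fun v => by
          conv_rhs => rw [show s = 1 + (s - 1) by ring, f.zpow_add_apply, zpow_one]
        rwa [h2, h2] at h1
    refine hwF.2 (mem_interior_iff_mem_nhds.2 ?_)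
    refine (biInter_mem (finite_Icc _ _)).2 fun s hs => ?_
    exact mem_of_superset ((isOpen_lt (continuous_const.dist (f ^ s).continuous)
      continuous_const).mem_nhds (hlt' s hs.1 hs.2)) fun v hv => by
        simp only [mem_ofPred_eq] at hv ⊢
        exact hv.le
  obtain ⟨_, hφ, v, hv, rfl⟩ := hΦA ((f ^ s) '' C) (hCj s) _ ⟨x, hxC, rfl⟩ _ ⟨w, hwC, rfl⟩ hdist
  refine htT.not_ge (hT (mem_iUnion₂.2 ⟨_, hφ, s, hs, hst, ?_, ?_, fun i hi hit => ?_⟩))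
  · rw [← f.zpow_add_apply, neg_add_cancel]
    exact hiff' v hv 0 le_rfl (by omega) (by rwa [f.zpow_zero_apply])
  · rw [← f.zpow_add_apply, sub_add_cancel]
    exact hiff' v hv t (by omega) le_rfl hxt
  · rw [← f.zpow_add_apply, sub_add_cancel]
    exact hiff v hv i hi.le hit.le (hxV i hi hit)

/-- If an orbit under a homeomorphism of a regular curve accumulates at a point `z` with infinite
orbit and at a recurrent point `y`, then the orbit of `z` accumulates at `y`. -/
lemma regularCurveAx.mem_closure_range_of_injective [MetricSpace X] [CompactSpace X]
    [PreconnectedSpace X] (hreg : regularCurveAx X) (f : X ≃ₜ X) {x y z : X}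
    (hz : MapClusterPt z atTop fun j : ℤ => (f ^ j) x)
    (hy : MapClusterPt y atTop fun j : ℤ => (f ^ j) x)
    (hyy : MapClusterPt y atTop fun j : ℤ => (f ^ j) y)
    (hinj : Function.Injective fun j : ℤ => (f ^ j) z) :
    y ∈ closure (range fun j : ℤ => (f ^ j) z) := by
  by_contra hnot
  obtain ⟨ε, hε, hεN⟩ := Metric.mem_nhds_iff.1 (isClosed_closure.isOpen_compl.mem_nhds hnot)
  obtain ⟨η, hη, rfl⟩ : ∃ η > 0, ε = 3 * η := ⟨ε / 3, by positivity, by ring⟩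
  have hfar : ∀ j : ℤ, 3 * η ≤ dist ((f ^ j) z) y := fun j => by
    by_contra! hlt
    exact hεN hlt (subset_closure ⟨j, rfl⟩)
  obtain ⟨Φ, hΦ, hΦA⟩ := hreg.exists_finite_inter_nonempty hη
  have hJ : {j : ℤ | (f ^ j) y ∈ ball y η}.Infinite := by
    refine infinite_of_not_bddAbove fun ⟨b, hb⟩ => ?_
    obtain ⟨j, hj, hjy⟩ := frequently_atTop.1
      (mapClusterPt_iff_frequently.1 hyy _ (ball_mem_nhds y hη)) (b + 1)
    have := hb hjy
    omega
  obtain ⟨J, hJsub, hJcard⟩ := hJ.exists_subset_card_eq (hΦ.toFinset.card + 1)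
  obtain ⟨U, hU, hUdisj⟩ := ((J : Set ℤ).toFinite.image fun j => (f ^ j) z).t2_separation
  have hnhds : ⋂ j ∈ (J : Set ℤ), (f ^ j) ⁻¹' U ((f ^ j) z) ∈ 𝓝 z :=
    (biInter_mem J.finite_toSet).2 fun j _ =>
      (f ^ j).continuous.continuousAt.preimage_mem_nhds ((hU _).2.mem_nhds (hU _).1)
  obtain ⟨A, hAz, hA, hAc⟩ := hreg.exists_isPreconnected_mem_nhds hnhds
  have hnhds' : ⋂ j ∈ (J : Set ℤ), (f ^ j) ⁻¹' ball ((f ^ j) y) η ∈ 𝓝 y :=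
    (biInter_mem J.finite_toSet).2 fun j _ =>
      (f ^ j).continuous.continuousAt.preimage_mem_nhds (ball_mem_nhds _ hη)
  obtain ⟨a, -, ha⟩ := frequently_atTop.1 (mapClusterPt_iff_frequently.1 hz _ hAz) 0
  obtain ⟨b, -, hb⟩ := frequently_atTop.1 (mapClusterPt_iff_frequently.1 hy _ hnhds') 0
  have hφ : ∀ j ∈ J, ∃ φ ∈ Φ, (f ^ (a - b)) φ ∈ (f ^ j) '' A := by
    intro j hj
    have hcomm : ∀ c : ℤ, (f ^ (a - b)) ((f ^ (b - a + j)) ((f ^ c) x)) =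
        (f ^ j) ((f ^ c) x) := fun c => by
      rw [← f.zpow_add_apply (a - b)]
      congr 2
      ring
    obtain ⟨_, hφ, v, hv, rfl⟩ := hΦA ((f ^ (b - a + j)) '' A)
      (hAc.image _ (f ^ (b - a + j)).continuous.continuousOn) _ ⟨z, mem_of_mem_nhds hAz, rfl⟩ _
      ⟨_, ha, rfl⟩ (by
        have h1 := hfar (b - a + j)
        have h2 : dist ((f ^ j) ((f ^ b) x)) ((f ^ j) y) < η := mem_iInter₂.1 hb j hj
        have h3 : dist ((f ^ j) y) y < η := hJsub hj
        rw [← f.zpow_add_apply, show j + b = b - a + j + a by ring, f.zpow_add_apply] at h2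
        have h4 := dist_triangle4 ((f ^ (b - a + j)) z) ((f ^ (b - a + j)) ((f ^ a) x))
          ((f ^ j) y) y
        linarith)
    refine ⟨_, hφ, v, hv, ?_⟩
    rw [← f.zpow_add_apply]
    congr 2
    ring
  have : Nonempty X := ⟨x⟩
  choose! φ hφΦ hφA using hφ
  obtain ⟨i, hi, j, hj, hij, heq⟩ := Finset.exists_ne_map_eq_of_card_lt_of_maps_to
    (s := J) (t := hΦ.toFinset) (f := φ) (by omega) (fun j hj => by simpa using hφΦ j hj)
  obtain ⟨v, hv, hvi⟩ := hφA i hi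
  obtain ⟨u, hu, huj⟩ := hφA j hj
  have h1 : (f ^ i) v ∈ U ((f ^ i) z) := mem_iInter₂.1 (hA hv) i hi
  have h2 : (f ^ j) u ∈ U ((f ^ j) z) := mem_iInter₂.1 (hA hu) j hj
  rw [huj, ← heq, ← hvi] at h2
  exact disjoint_left.1 (hUdisj ⟨i, hi, rfl⟩ ⟨j, hj, rfl⟩ fun h => hij (hinj h)) h1 h2

lemma nonwandering_of_mapClusterPt [TopologicalSpace X] (f : X ≃ₜ X) {x z : X}
    (hz : MapClusterPt z atTop fun j : ℤ => (f ^ j) x) {O : Set X} (hO : O ∈ 𝓝 z) :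
    (∃ᶠ j : ℤ in atTop, ∃ w ∈ O, (f ^ j) w ∈ O) ∧
      ∃ᶠ j : ℤ in atTop, ∃ w ∈ O, (f⁻¹ ^ j) w ∈ O := by
  have hf := frequently_atTop.1 (mapClusterPt_iff_frequently.1 hz O hO)
  obtain ⟨a, -, ha⟩ := hf 0
  constructor <;> refine frequently_atTop.2 fun T => ?_ <;>
    obtain ⟨b, hb, hbO⟩ := hf (a + T) <;> refine ⟨b - a, by omega, ?_⟩
  · refine ⟨_, ha, ?_⟩
    rwa [← f.zpow_add_apply, sub_add_cancel]
  · refine ⟨_, hbO, ?_⟩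
    rwa [inv_zpow', ← f.zpow_add_apply, neg_sub, sub_add_cancel]

lemma zpow_apply_mem_of_recurrent [TopologicalSpace X] (f : X ≃ₜ X) {q : X}
    (hq : MapClusterPt q atTop fun j : ℤ => (f ^ j) q) {K : Set X} (hK : IsClosed K)
    (h : ∀ l : ℤ, 0 ≤ l → (f ^ l) q ∈ K) (m : ℤ) : (f ^ m) q ∈ K := by
  by_contra hm
  obtain ⟨j, hj, hjK⟩ := frequently_atTop.1 (mapClusterPt_iff_frequently.1 hq _
    ((f ^ m).continuous.continuousAt.preimage_mem_nhds (hK.isOpen_compl.mem_nhds hm))) (-m)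
  refine hjK ?_
  rw [← f.zpow_add_apply]
  exact h _ (by omega)

lemma finite_range_zpow_apply_of_not_injective [TopologicalSpace X] (f : X ≃ₜ X) {q : X}
    (h : ¬ Function.Injective fun j : ℤ => (f ^ j) q) :
    (range fun j : ℤ => (f ^ j) q).Finite := by
  obtain ⟨r, hr, hrq⟩ : ∃ r : ℤ, r ≠ 0 ∧ (f ^ r) q = q := by
    simp only [Function.Injective, not_forall] at h
    obtain ⟨m, n, hmn, hne⟩ := h
    refine ⟨m - n, sub_ne_zero.2 hne, ?_⟩
    rw [sub_eq_neg_add, f.zpow_add_apply, hmn, ← f.zpow_add_apply, neg_add_cancel,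
      f.zpow_zero_apply]
  have hmul : ∀ k : ℤ, (f ^ (r * k)) q = q := by
    intro k
    induction k using Int.induction_on with
    | zero => rw [mul_zero, f.zpow_zero_apply]
    | succ i ih => rw [mul_add, mul_one, f.zpow_add_apply, hrq, ih]
    | pred i ih =>
      rw [mul_sub, mul_one, sub_eq_add_neg, f.zpow_add_apply,
        (f.zpow_neg_apply_eq_iff r q q).2 hrq.symm, ih]
  refine ((finite_Icc 0 |r|).image fun j : ℤ => (f ^ j) q).subset ?_
  rintro _ ⟨m, rfl⟩
  refine ⟨m % r, ⟨Int.emod_nonneg _ hr, (Int.emod_lt_abs _ hr).le⟩, ?_⟩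
  simp only
  conv_rhs => rw [← Int.emod_add_mul_ediv m r, f.zpow_add_apply, hmul]

/-- If the orbit of `x` accumulates both on a closed invariant set `N ⊆ V` at `p` and outside the
closure of `V`, then it has arbitrarily long excursions into `V` passing arbitrarily close to
`p`; these are shadowed by the orbit of a single point of the frontier of `V`. -/
lemma regularCurveAx.exists_frequently_shadowing [MetricSpace X] [CompactSpace X]
    [PreconnectedSpace X] (hreg : regularCurveAx X) (f : X ≃ₜ X) {V : Set X} (hV : IsOpen V)
    (hVfin : (frontier V).Finite) {x p y : X} (hpV : ∀ m : ℤ, (f ^ m) p ∈ V)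
    (hp : MapClusterPt p atTop fun j : ℤ => (f ^ j) x) (hyV : y ∉ closure V)
    (hy : MapClusterPt y atTop fun j : ℤ => (f ^ j) x) :
    ∃ q ∈ frontier V, ∃ᶠ k : ℤ in atTop, ∃ a τ c b : ℤ, k ≤ a ∧ a ≤ τ ∧ τ ≤ b ∧ a + k ≤ c ∧
      c + k ≤ b ∧ dist ((f ^ c) x) p ≤ (k : ℝ)⁻¹ ∧ (∀ i, a < i → i < b → (f ^ i) x ∈ V) ∧
      ∀ i, a ≤ i → i ≤ b → dist ((f ^ i) x) ((f ^ (i - τ)) q) ≤ (k : ℝ)⁻¹ := by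
  refine frequently_atTop_exists_mem_finite hVfin (frequently_atTop.2 fun K => ?_)
  set k := max K 1 with hk
  have hk1 : 1 ≤ k := le_max_right _ _
  have hkpos : 0 < (k : ℝ)⁻¹ := inv_pos.2 (by exact_mod_cast hk1)
  obtain ⟨T, hT⟩ := hreg.exists_shadowing_excursions f hV hkpos
  set k' := max k T with hk'
  have hkk' : k ≤ k' := le_max_left _ _
  have hTk' : T ≤ k' := le_max_right _ _
  have hnhds : ball p (k : ℝ)⁻¹ ∩ ⋂ s ∈ Icc (-k') k', (f ^ s) ⁻¹' V ∈ 𝓝 p := by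
    refine inter_mem (ball_mem_nhds _ hkpos) ((biInter_mem (finite_Icc _ _)).2 fun s _ => ?_)
    exact (f ^ s).continuous.continuousAt.preimage_mem_nhds (hV.mem_nhds (hpV s))
  have hyf := frequently_atTop.1
    (mapClusterPt_iff_frequently.1 hy _ (isClosed_closure.isOpen_compl.mem_nhds hyV))
  obtain ⟨m, hm, hmV⟩ := hyf k
  obtain ⟨c, hc, hcp, hcV⟩ := frequently_atTop.1 (mapClusterPt_iff_frequently.1 hp _ hnhds) m
  obtain ⟨m', hm', hmV'⟩ := hyf c
  have hnear : ∀ i, c - k' ≤ i → i ≤ c + k' → (f ^ i) x ∈ V := by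
    intro i h1 h2
    have h3 : (f ^ (i - c)) ((f ^ c) x) ∈ V :=
      mem_iInter₂.1 hcV (i - c) ⟨by omega, by omega⟩
    rwa [← f.zpow_add_apply, sub_add_cancel] at h3
  obtain ⟨a, ⟨hac, haV⟩, hamax⟩ := Int.exists_greatest_of_bdd
    (P := fun i => i ≤ c ∧ (f ^ i) x ∉ V) ⟨c, fun i hi => hi.1⟩
    ⟨m, hc, fun h => hmV (subset_closure h)⟩
  obtain ⟨b, ⟨hcb, hbV⟩, hbmin⟩ := Int.exists_least_of_bdd
    (P := fun i => c ≤ i ∧ (f ^ i) x ∉ V) ⟨c, fun i hi => hi.1⟩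
    ⟨m', hm', fun h => hmV' (subset_closure h)⟩
  have ham : m ≤ a := hamax m ⟨hc, fun h => hmV (subset_closure h)⟩
  have hac' : a < c - k' := by
    by_contra! h
    exact haV (hnear a h (by omega))
  have hcb' : c + k' < b := by
    by_contra! h
    exact hbV (hnear b (by omega) h)
  have hab : ∀ i, a < i → i < b → (f ^ i) x ∈ V := by
    intro i h1 h2
    by_contra hi
    rcases le_total i c with h | h
    · exact h1.not_ge (hamax i ⟨h, hi⟩)
    · exact h2.not_ge (hbmin i ⟨h, hi⟩)
  obtain ⟨q, hq, j, hj, hjt, hsh⟩ := hT (b - a) (by omega) ((f ^ a) x) haV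
    (fun s h1 h2 => by
      rw [← f.zpow_add_apply]
      exact hab _ (by omega) (by omega))
    (by rwa [← f.zpow_add_apply, sub_add_cancel])
  refine ⟨k, le_max_left _ _, q, hq, a, a + j, c, b, by omega, by omega, by omega, by omega,
    by omega, (mem_ball.1 hcp).le, hab, fun i h1 h2 => ?_⟩
  have := hsh (i - a) (by omega) (by omega)
  rwa [← f.zpow_add_apply, sub_add_cancel, sub_sub] at this

/-- Two cluster points of an orbit under a homeomorphism of a regular curve cannot be separated by
a closed invariant set of cluster points. -/
lemma regularCurveAx.mem_of_mapClusterPt [MetricSpace X] [CompactSpace X]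
    [PreconnectedSpace X] (hreg : regularCurveAx X) (f : X ≃ₜ X) {x y p : X} {N : Set X}
    (hN : IsClosed N) (hNinv : ∀ w ∈ N, ∀ m : ℤ, (f ^ m) w ∈ N) (hpN : p ∈ N)
    (hp : MapClusterPt p atTop fun j : ℤ => (f ^ j) x)
    (hy : MapClusterPt y atTop fun j : ℤ => (f ^ j) x) : y ∈ N := by
  by_contra hyN
  obtain ⟨V, hV, hNV, hVO, hVfin⟩ : ∃ V, IsOpen V ∧ N ⊆ V ∧ y ∉ closure V ∧
      (frontier V).Finite := by
    obtain ⟨O, hO, hOc, hON⟩ := exists_mem_nhds_isClosed_subset (hN.isOpen_compl.mem_nhds hyN)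
    obtain ⟨V, hV, hNV, hVO, hfin⟩ := hreg.exists_isOpen_finite_frontier hN.isCompact
      hOc.isOpen_compl fun w hw hwO => hON hwO hw
    refine ⟨V, hV, hNV, fun hyc => ?_, hfin⟩
    obtain ⟨w, hwO, hwV⟩ := mem_closure_iff_nhds.1 hyc O hO
    exact hVO hwV hwO
  obtain ⟨q, hqF, hfreq⟩ := hreg.exists_frequently_shadowing f hV hVfin
    (fun m => hNV (hNinv p hpN m)) hp hVO hy
  have hsmall : ∀ ε > 0, ∀ᶠ k : ℤ in atTop, (k : ℝ)⁻¹ < ε := fun ε hε =>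
    (tendsto_inv_atTop_zero.comp tendsto_intCast_atTop_atTop).eventually_lt_const hε
  have hqx : MapClusterPt q atTop fun j : ℤ => (f ^ j) x := by
    refine mapClusterPt_iff_frequently.2 fun O hO => frequently_atTop.2 fun T => ?_
    obtain ⟨ε, hε, hεO⟩ := Metric.mem_nhds_iff.1 hO
    obtain ⟨k, ⟨a, τ, c, b, hka, haτ, hτb, -, -, -, -, hsh⟩, hkε, hkT⟩ :=
      (hfreq.and_eventually ((hsmall ε hε).and (eventually_ge_atTop T))).exists
    refine ⟨τ, by omega, hεO ?_⟩
    have := hsh τ haτ hτb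
    rw [sub_self, f.zpow_zero_apply] at this
    exact this.trans_lt hkε
  have hpq : p ∈ closure (range fun j : ℤ => (f ^ j) q) := by
    refine Metric.mem_closure_iff.2 fun ε hε => ?_
    obtain ⟨k, ⟨a, τ, c, b, hka, haτ, hτb, hac, hcb, hcp, -, hsh⟩, hkε, hk0⟩ :=
      (hfreq.and_eventually ((hsmall (ε / 2) (half_pos hε)).and (eventually_ge_atTop 0))).exists
    refine ⟨_, ⟨c - τ, rfl⟩, ?_⟩
    have := hsh c (by omega) (by omega)
    linarith [dist_triangle_left p ((f ^ (c - τ)) q) ((f ^ c) x)]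
  have hclosure : ∀ m : ℤ, (f ^ m) q ∈ closure V := by
    have hq0 : q ∈ closure V := frontier_subset_closure hqF
    have hor : ∃ᶠ k : ℤ in atTop,
        (∀ l : ℤ, 0 < l → l < k → ∃ v ∈ V, dist ((f ^ l) q) v ≤ (k : ℝ)⁻¹) ∨
        (∀ l : ℤ, 0 < l → l < k → ∃ v ∈ V, dist ((f⁻¹ ^ l) q) v ≤ (k : ℝ)⁻¹) := by
      refine hfreq.mono ?_
      rintro k ⟨a, τ, c, b, hka, haτ, hτb, hac, hcb, -, hab, hsh⟩
      rcases le_total τ c with h | h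
      · refine Or.inl fun l hl hlk => ⟨_, hab (τ + l) (by omega) (by omega), ?_⟩
        have := hsh (τ + l) (by omega) (by omega)
        rwa [dist_comm, add_sub_cancel_left] at this
      · refine Or.inr fun l hl hlk => ⟨_, hab (τ - l) (by omega) (by omega), ?_⟩
        have := hsh (τ - l) (by omega) (by omega)
        rwa [dist_comm, sub_sub_cancel_left, ← inv_zpow'] at this
    have hhalf : ∀ g : X ≃ₜ X, (∃ᶠ k : ℤ in atTop,
        ∀ l : ℤ, 0 < l → l < k → ∃ v ∈ V, dist ((g ^ l) q) v ≤ (k : ℝ)⁻¹) →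
        ∀ l : ℤ, 0 ≤ l → (g ^ l) q ∈ closure V := by
      intro g hg l hl
      rcases hl.eq_or_lt with rfl | hl
      · rwa [g.zpow_zero_apply]
      refine Metric.mem_closure_iff.2 fun ε hε => ?_
      obtain ⟨k, hk, hkε, hkl⟩ :=
        (hg.and_eventually ((hsmall ε hε).and (eventually_gt_atTop l))).exists
      obtain ⟨v, hv, hdist⟩ := hk l hl hkl
      exact ⟨v, hv, hdist.trans_lt hkε⟩
    rcases frequently_or_distrib.1 hor with h | h
    · exact zpow_apply_mem_of_recurrent f (hreg.recurrent_of_nonwandering f fun O hO =>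
        (nonwandering_of_mapClusterPt f hqx hO).1) isClosed_closure (hhalf f h)
    · intro m
      have := zpow_apply_mem_of_recurrent f⁻¹ (hreg.recurrent_of_nonwandering f⁻¹ fun O hO =>
        (nonwandering_of_mapClusterPt f hqx hO).2) isClosed_closure (hhalf f⁻¹ h) (-m)
      rwa [inv_zpow', neg_neg] at this
  have hninj : ¬ Function.Injective fun j : ℤ => (f ^ j) q := fun hinj =>
    hVO <| closure_minimal (range_subset_iff.2 hclosure) isClosed_closure <|
      hreg.mem_closure_range_of_injective f hqx hy (hreg.recurrent_of_nonwandering f fun O hO =>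
        (nonwandering_of_mapClusterPt f hy hO).1) hinj
  rw [(finite_range_zpow_apply_of_not_injective f hninj).isClosed.closure_eq] at hpq
  obtain ⟨i, hi⟩ := hpq
  have hqN : q ∈ N := by
    rw [← (f.zpow_neg_apply_eq_iff i q p).2 hi.symm]
    exact hNinv p hpN _
  rw [hV.frontier_eq] at hqF
  exact hqF.2 (hNV hqN)

lemma Homeomorph.iterate_eq_zpow [TopologicalSpace X] (f : X ≃ₜ X) (n : ℕ) (x : X) :
    f^[n] x = (f ^ (n : ℤ)) x := by
  induction n with
  | zero => simp
  | succ n ih =>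
    rw [Function.iterate_succ_apply', ih, Nat.cast_succ, add_comm, f.zpow_add_apply, zpow_one]

lemma mem_omegaSet_iff_mapClusterPt [MetricSpace X] (f : X ≃ₜ X) {x y : X} :
    y ∈ omegaSet f x ↔ MapClusterPt y atTop fun j : ℤ => (f ^ j) x := by
  constructor
  · rintro ⟨n, hn, hlim⟩
    refine mapClusterPt_iff_frequently.2 fun O hO => frequently_atTop.2 fun T => ?_
    obtain ⟨i, hiO, hiT⟩ := ((hlim.eventually_mem hO).and (eventually_ge_atTop T.toNat)).exists
    rw [f.iterate_eq_zpow] at hiO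
    exact ⟨n i, by have := hn.le_apply (x := i); omega, hiO⟩
  · intro h
    refine MapClusterPt.tendsto_subseq (x := y)
      (u := fun n : ℕ => f^[n] x) ?_
    refine mapClusterPt_iff_frequently.2 fun O hO => frequently_atTop.2 fun T => ?_
    obtain ⟨j, hj, hjO⟩ := frequently_atTop.1 (mapClusterPt_iff_frequently.1 h O hO) T
    refine ⟨j.toNat, by omega, ?_⟩
    rwa [f.iterate_eq_zpow, Int.toNat_of_nonneg (by omega)]

lemma zpow_apply_mem_of_image_eq [TopologicalSpace X] (f : X ≃ₜ X) {N : Set X} (h : f '' N = N)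
    {w : X} (hw : w ∈ N) (m : ℤ) : (f ^ m) w ∈ N := by
  induction m using Int.induction_on with
  | zero => rwa [f.zpow_zero_apply]
  | succ i ih =>
    rw [add_comm, f.zpow_add_apply, zpow_one, ← h]
    exact mem_image_of_mem _ ih
  | pred i ih =>
    rw [sub_eq_neg_add, f.zpow_add_apply]
    rw [← h] at ih
    obtain ⟨v, hv, hvw⟩ := ih
    rwa [(f.zpow_neg_apply_eq_iff 1 v _).2 (by rw [zpow_one, hvw])]

lemma mapClusterPt_zpow_apply [TopologicalSpace X] (f : X ≃ₜ X) {x y : X}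
    (h : MapClusterPt y atTop fun j : ℤ => (f ^ j) x) (m : ℤ) :
    MapClusterPt ((f ^ m) y) atTop fun j : ℤ => (f ^ j) x := by
  refine mapClusterPt_iff_frequently.2 fun O hO => frequently_atTop.2 fun T => ?_
  obtain ⟨j, hj, hjO⟩ := frequently_atTop.1 (mapClusterPt_iff_frequently.1 h _
    ((f ^ m).continuous.continuousAt.preimage_mem_nhds hO)) (T - m)
  refine ⟨m + j, by omega, ?_⟩
  rwa [f.zpow_add_apply]

/-- For homeomorphisms of regular curves, ω-limit sets are minimal. -/
lemma regularCurveAx.isMinimalSet_omegaSet [MetricSpace X] [CompactSpace X]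
    [PreconnectedSpace X] (hreg : regularCurveAx X) (f : X ≃ₜ X) (x : X) :
    IsMinimalSet f (omegaSet f x) := by
  have hmem := fun y => mem_omegaSet_iff_mapClusterPt f (x := x) (y := y)
  refine ⟨?_, ?_, ?_, fun N hNsub ⟨p, hpN⟩ hN hNinv => hNsub.antisymm fun y hy => ?_⟩
  · obtain ⟨y, hy⟩ := exists_clusterPt_of_compactSpace (map (fun j : ℤ => (f ^ j) x) atTop)
    exact ⟨y, (hmem y).2 hy⟩
  · have : omegaSet f x = {y | ClusterPt y (map (fun j : ℤ => (f ^ j) x) atTop)} := ext hmem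
    rw [this]
    exact isClosed_setOfPred_clusterPt
  · ext y
    constructor
    · rintro ⟨w, hw, rfl⟩
      have := mapClusterPt_zpow_apply f ((hmem w).1 hw) 1
      rw [zpow_one] at this
      exact (hmem _).2 this
    · intro hy
      refine ⟨(f ^ (-1 : ℤ)) y, (hmem _).2 (mapClusterPt_zpow_apply f ((hmem y).1 hy) _), ?_⟩
      have := f.zpow_add_apply 1 (-1) y
      rw [zpow_one, add_neg_cancel, f.zpow_zero_apply] at this
      exact this.symm
  · exact hreg.mem_of_mapClusterPt f hN (fun w hw => zpow_apply_mem_of_image_eq f hNinv hw) hpN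
      ((hmem p).1 (hNsub hpN)) ((hmem y).1 hy)

lemma Homeomorph.symm_image_eq_self_iff [TopologicalSpace X] (f : X ≃ₜ X) {N : Set X} :
    f.symm '' N = N ↔ f '' N = N := by
  rw [f.symm.image_eq_preimage_symm, f.symm_symm]
  constructor <;> intro h
  · conv_lhs => rw [← h]
    exact f.image_preimage N
  · conv_lhs => rw [← h]
    exact f.preimage_image N

lemma IsMinimalSet.of_symm [MetricSpace X] {f : X ≃ₜ X} {M : Set X}
    (h : IsMinimalSet f.symm M) : IsMinimalSet f M :=
  ⟨h.1, h.2.1, f.symm_image_eq_self_iff.1 h.2.2.1, fun N hNM hN hNc hNinv =>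
    h.2.2.2 N hNM hN hNc (f.symm_image_eq_self_iff.2 hNinv)⟩

end Dynamics

/-- For a homeomorphism of a regular curve, every ω-limit set and every α-limit
set is minimal. -/
theorem omegaSet_and_alphaSet_minimal {X : Type*} [MetricSpace X] [Nonempty X]
    [CompactSpace X] [ConnectedSpace X] (hreg : regularCurveAx X) (f : X ≃ₜ X) :
    ∀ x : X, IsMinimalSet (⇑f) (omegaSet (⇑f) x) ∧
      IsMinimalSet (⇑f) (omegaSet (⇑f.symm) x) :=
  fun x => ⟨hreg.isMinimalSet_omegaSet f x, (hreg.isMinimalSet_omegaSet f.symm x).of_symm⟩
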